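/- (Proposition 9, finite case) Let F be a finite rank-one POVM on ℂ^d, i.e. F(x) = τ(x) • π(v_x) for unit vectors v_x ∈ ℂ^d and reals τ(x) > 0 with ∑_x τ(x) • π(v_x) = I. Then F is a tight IC-POVM if and only if ∑_x τ(x) • (π(v_x) ⊗ π(v_x)) = (d+1)⁻¹ • (I⊗I + T), i.e. if and only if the outcome distribution (v, τ/d) is a weighted 2-design of dimension d. -/

import Mathlib

open scoped Kronecker
open Matrix

noncomputable def proj {d : ℕ} (v : EuclideanSpace ℂ (Fin d)) : Matrix (Fin d) (Fin d) ℂ :=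
  Matrix.of fun i j => v i * (starRingEnd ℂ) (v j)

noncomputable def swapMatrix (d : ℕ) : Matrix (Fin d × Fin d) (Fin d × Fin d) ℂ :=
  Matrix.of fun p q => if p.1 = q.2 ∧ p.2 = q.1 then 1 else 0

/-- `F` (with trace measure `τ` and POVD `P`) is a tight IC-POVM: the traceless parts of the
`P x` form a tight operator frame on the space of traceless operators. -/
def TightIC {d : ℕ} {ι : Type*} [Fintype ι]
    (τ : ι → ℝ) (P : ι → Matrix (Fin d) (Fin d) ℂ) : Prop :=
  ∃ a : ℝ, 0 < a ∧ ∀ A : Matrix (Fin d) (Fin d) ℂ,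
    ∑ x, (τ x : ℂ) •
        (Matrix.trace ((P x - (d : ℂ)⁻¹ • 1)ᴴ * A) • (P x - (d : ℂ)⁻¹ • 1))
      = (a : ℂ) • (A - ((d : ℂ)⁻¹ * Matrix.trace A) • 1)

theorem proj_isHermitian {d : ℕ} (v : EuclideanSpace ℂ (Fin d)) : (proj v).IsHermitian := by
  ext i j
  simp [proj, mul_comm]

theorem trace_proj {d : ℕ} {v : EuclideanSpace ℂ (Fin d)} (hv : ‖v‖ = 1) :
    (proj v).trace = 1 := by
  have h : ((∑ i, ‖v i‖ ^ 2 : ℝ) : ℂ) = 1 := by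
    rw [← EuclideanSpace.norm_sq_eq, hv]
    norm_num
  rw [← h]
  simp [Matrix.trace, proj, Complex.mul_conj']

theorem proj_mul_proj_swap {d : ℕ} (v : EuclideanSpace ℂ (Fin d)) (i j k l : Fin d) :
    proj v i j * proj v k l = proj v i l * proj v k j := by
  simp only [proj, Matrix.of_apply]
  ring

/-- The total weight of a POVM with normalized effects of trace one is the dimension. -/
theorem sum_weight_eq_card {d : ℕ} {ι : Type*} [Fintype ι] {c : ι → ℂ}
    {P : ι → Matrix (Fin d) (Fin d) ℂ} (htr : ∀ x, (P x).trace = 1)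
    (hsum : ∑ x, c x • P x = 1) : ∑ x, c x = d := by
  have h := congrArg Matrix.trace hsum
  simpa [Matrix.trace_sum, htr] using h

/-- The frame operator of the traceless parts in terms of the frame operator of the effects. -/
theorem sum_traceless_frame {d : ℕ} (hd : d ≠ 0) {ι : Type*} [Fintype ι] {c : ι → ℂ}
    {P : ι → Matrix (Fin d) (Fin d) ℂ} (hherm : ∀ x, (P x).IsHermitian)
    (htr : ∀ x, (P x).trace = 1) (hsum : ∑ x, c x • P x = 1)
    (A : Matrix (Fin d) (Fin d) ℂ) :
    ∑ x, c x • (Matrix.trace ((P x - (d : ℂ)⁻¹ • 1)ᴴ * A) • (P x - (d : ℂ)⁻¹ • 1))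
      = ∑ x, c x • (Matrix.trace (P x * A) • P x) - ((d : ℂ)⁻¹ * A.trace) • 1 := by
  have hd' : (d : ℂ) ≠ 0 := Nat.cast_ne_zero.mpr hd
  have hc := sum_weight_eq_card htr hsum
  have hA : ∑ x, c x * Matrix.trace (P x * A) = A.trace := by
    have h := congrArg (fun M => Matrix.trace (M * A)) hsum
    simpa [Finset.sum_mul, Matrix.trace_sum] using h
  have hterm : ∀ x, c x • (Matrix.trace ((P x - (d : ℂ)⁻¹ • 1)ᴴ * A) • (P x - (d : ℂ)⁻¹ • 1))
      = c x • (Matrix.trace (P x * A) • P x) - ((d : ℂ)⁻¹ * A.trace) • (c x • P x)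
        - (c x * Matrix.trace (P x * A)) • ((d : ℂ)⁻¹ • (1 : Matrix (Fin d) (Fin d) ℂ))
        + c x • (((d : ℂ)⁻¹ * A.trace * (d : ℂ)⁻¹) • (1 : Matrix (Fin d) (Fin d) ℂ)) := by
    intro x
    have h : Matrix.trace ((P x - (d : ℂ)⁻¹ • 1)ᴴ * A)
        = Matrix.trace (P x * A) - (d : ℂ)⁻¹ * A.trace := by
      simp [Matrix.conjTranspose_sub, (hherm x).eq, Matrix.sub_mul]
    rw [h]
    module
  simp_rw [hterm]
  rw [Finset.sum_add_distrib, Finset.sum_sub_distrib, Finset.sum_sub_distrib, ← Finset.smul_sum,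
    ← Finset.sum_smul, ← Finset.sum_smul, hsum, hA, hc]
  match_scalars
  · ring
  · linear_combination ((d : ℂ)⁻¹ * A.trace) * mul_inv_cancel₀ hd'

/-- The 2-design condition, written entrywise. -/
theorem sum_kronecker_eq_iff {d : ℕ} {ι : Type*} [Fintype ι] (τ : ι → ℝ)
    (P : ι → Matrix (Fin d) (Fin d) ℂ) :
    ∑ x, τ x • (P x ⊗ₖ P x)
        = ((d : ℝ) + 1)⁻¹ •
            ((1 : Matrix (Fin d) (Fin d) ℂ) ⊗ₖ (1 : Matrix (Fin d) (Fin d) ℂ) + swapMatrix d)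
    ↔ ∀ i j k l, ∑ x, (τ x : ℂ) * (P x i j * P x k l)
        = ((d : ℂ) + 1)⁻¹ *
            ((if i = j then 1 else 0) * (if k = l then 1 else 0)
              + (if i = l then 1 else 0) * (if k = j then 1 else 0)) := by
  constructor
  · intro h i j k l
    simpa [Matrix.sum_apply, Matrix.one_apply, swapMatrix, mul_add, ← ite_and, and_comm]
      using congrFun (congrFun h (i, k)) (j, l)
  · intro h
    ext ⟨i, k⟩ ⟨j, l⟩
    simpa [Matrix.sum_apply, Matrix.one_apply, swapMatrix, mul_add, ← ite_and, and_comm]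
      using h i j k l

theorem sum_trace_smul_apply {d : ℕ} {ι : Type*} [Fintype ι] (c : ι → ℂ)
    (P : ι → Matrix (Fin d) (Fin d) ℂ) (A : Matrix (Fin d) (Fin d) ℂ) (i j : Fin d) :
    (∑ x, c x • (Matrix.trace (P x * A) • P x)) i j
      = ∑ k, ∑ l, A l k * ∑ x, c x * (P x i j * P x k l) := by
  simp only [Matrix.sum_apply, Matrix.smul_apply, smul_eq_mul, Matrix.trace, Matrix.diag_apply,
    Matrix.mul_apply, Finset.mul_sum, Finset.sum_mul]
  rw [Finset.sum_comm]
  refine Finset.sum_congr rfl fun k _ => ?_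
  rw [Finset.sum_comm]
  refine Finset.sum_congr rfl fun l _ => Finset.sum_congr rfl fun x _ => ?_
  ring

theorem stmt10 {d : ℕ} (hd : 1 ≤ d) {ι : Type*} [Fintype ι]
    (v : ι → EuclideanSpace ℂ (Fin d)) (hv : ∀ x, ‖v x‖ = 1)
    (τ : ι → ℝ) (hτpos : ∀ x, 0 < τ x)
    (hsum : ∑ x, τ x • proj (v x) = 1) :
    TightIC τ (fun x => proj (v x))
    ↔ ∑ x, τ x • (proj (v x) ⊗ₖ proj (v x))
        = ((d : ℝ) + 1)⁻¹ •
            ((1 : Matrix (Fin d) (Fin d) ℂ) ⊗ₖ (1 : Matrix (Fin d) (Fin d) ℂ) + swapMatrix d) := by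
  have hd0 : d ≠ 0 := by omega
  have hsum' : ∑ x, (τ x : ℂ) • proj (v x) = 1 := by simpa using hsum
  have hframe := sum_traceless_frame hd0 (fun x => proj_isHermitian (v x))
    (fun x => trace_proj (hv x)) hsum'
  rw [sum_kronecker_eq_iff]
  simp only [TightIC, hframe]
  constructor
  · rintro ⟨a, -, ha⟩
    have hG : ∀ i j k l, ∑ x, (τ x : ℂ) * (proj (v x) i j * proj (v x) k l)
        = a * ((if i = l then 1 else 0) * (if k = j then 1 else 0))
          + (1 - a) * (d : ℂ)⁻¹ * ((if i = j then 1 else 0) * (if k = l then 1 else 0)) := by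
      intro i j k l
      have h := congrFun (congrFun (ha (Matrix.single l k 1)) i) j
      rw [Matrix.sub_apply, sum_trace_smul_apply] at h
      have hsingle : ∑ k', ∑ l', Matrix.single l k (1 : ℂ) l' k' *
          ∑ x, (τ x : ℂ) * (proj (v x) i j * proj (v x) k' l')
          = ∑ x, (τ x : ℂ) * (proj (v x) i j * proj (v x) k l) := by
        simp [Matrix.single_apply, ite_and]
      have htrace : Matrix.trace (Matrix.single l k (1 : ℂ)) = if k = l then 1 else 0 := by
        split_ifs with hkl
        · simp [hkl]
        · exact Matrix.trace_single_eq_of_ne _ _ _ (Ne.symm hkl)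
      have hentry : Matrix.single l k (1 : ℂ) i j
          = (if i = l then 1 else 0) * (if k = j then 1 else 0) := by
        simp [Matrix.single_apply, ← ite_and, and_comm, eq_comm]
      rw [hsingle, htrace] at h
      simp only [Matrix.smul_apply, Matrix.sub_apply, smul_eq_mul, hentry, Matrix.one_apply] at h
      linear_combination h
    intro i j k l
    rcases eq_or_ne d 1 with rfl | hd2
    · rw [hG]
      simp only [Subsingleton.elim j i, Subsingleton.elim k i, Subsingleton.elim l i]
      norm_num
    · have hlt : 1 < d := by omega
      have hswap := hG ⟨0, by omega⟩ ⟨1, hlt⟩ ⟨1, hlt⟩ ⟨0, by omega⟩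
      simp_rw [proj_mul_proj_swap _ _ (⟨1, hlt⟩ : Fin d)] at hswap
      rw [hG] at hswap
      simp only [Fin.mk.injEq, zero_ne_one, one_ne_zero, if_true, if_false] at hswap
      have ha' : (a : ℂ) = ((d : ℂ) + 1)⁻¹ := by
        field_simp at hswap ⊢
        linear_combination -hswap
      rw [hG, ha']
      field_simp
      ring
  · intro hG
    refine ⟨((d : ℝ) + 1)⁻¹, by positivity, fun A => ?_⟩
    ext i j
    rw [Matrix.sub_apply, sum_trace_smul_apply]
    simp_rw [hG]
    have hcontract : ∑ k, ∑ l, A l k * (((d : ℂ) + 1)⁻¹ *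
        ((if i = j then 1 else 0) * (if k = l then 1 else 0)
          + (if i = l then 1 else 0) * (if k = j then 1 else 0)))
        = ((d : ℂ) + 1)⁻¹ * ((if i = j then 1 else 0) * A.trace + A i j) := by
      simp_rw [mul_left_comm _ ((d : ℂ) + 1)⁻¹, ← Finset.mul_sum, mul_add, Finset.sum_add_distrib]
      simp [Matrix.trace, mul_add]
    rw [hcontract]
    simp only [Matrix.smul_apply, Matrix.sub_apply, smul_eq_mul, Matrix.one_apply]
    push_cast
    field_simp
    ring
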